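/- arXiv:2511.20062 — 2 statements merged into one kernel-verified Lean document; each statement's English description precedes it below -/
import Mathlib

section
/- Let N : ℝ → ℝ be 2π-periodic, square-integrable on [0, 2π], even (N(-φ) = N(φ) for almost every φ) and π-periodic (N(φ + π) = N(φ) for almost every φ). If ∫_0^{2π} N(φ) · sin(φ)^{2j} dφ = 0 for every natural number j ≥ 0, then N = 0 almost everywhere. -/
open Real MeasureTheory

lemma fold_aux (F : ℝ → ℝ) (hF : IntervalIntegrable F volume 0 (2 * π))
    (heven : ∀ᵐ φ : ℝ, F (-φ) = F φ)
    (hpi : ∀ᵐ φ : ℝ, F (φ + π) = F φ) :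
    ∫ φ in (0:ℝ)..(2 * π), F φ = 4 * ∫ φ in (0:ℝ)..(π / 2), F φ := by
  have hp := Real.pi_pos
  have sub : ∀ a b : ℝ, 0 ≤ a → a ≤ b → b ≤ 2 * π → IntervalIntegrable F volume a b := by
    intro a b h0 hab hb
    apply hF.mono_set
    rw [Set.uIcc_of_le hab, Set.uIcc_of_le (by linarith)]
    exact Set.Icc_subset_Icc h0 hb
  have e1 : ∫ φ in (π:ℝ)..(2 * π), F φ = ∫ φ in (0:ℝ)..π, F φ := by
    have : ∫ φ in (0:ℝ)..π, F (φ + π) = ∫ φ in (π:ℝ)..(2 * π), F φ := by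
      rw [intervalIntegral.integral_comp_add_right]
      congr 1 <;> ring
    rw [← this]
    apply intervalIntegral.integral_congr_ae
    filter_upwards [hpi] with x hx _ using hx
  have e2 : ∫ φ in (π / 2)..π, F φ = ∫ φ in (0:ℝ)..(π / 2), F φ := by
    have h1 : ∫ φ in (-(π / 2))..0, F (φ + π) = ∫ φ in (π / 2)..π, F φ := by
      rw [intervalIntegral.integral_comp_add_right]
      congr 1 <;> ring
    have h2 : ∫ φ in (0:ℝ)..(π / 2), F (-φ) = ∫ φ in (-(π / 2))..0, F φ := by
      rw [intervalIntegral.integral_comp_neg]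
      simp
    rw [← h1]
    trans ∫ φ in (-(π / 2))..0, F φ
    · apply intervalIntegral.integral_congr_ae
      filter_upwards [hpi] with x hx _ using hx
    · rw [← h2]
      apply intervalIntegral.integral_congr_ae
      filter_upwards [heven] with x hx _ using hx
  rw [← intervalIntegral.integral_add_adjacent_intervals
      (sub 0 π le_rfl hp.le (by linarith)) (sub π (2 * π) hp.le (by linarith) le_rfl), e1,
    ← intervalIntegral.integral_add_adjacent_intervals
      (sub 0 (π / 2) le_rfl (by linarith) (by linarith))
      (sub (π / 2) π (by linarith) (by linarith) (by linarith)), e2]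
  ring

lemma poly_aux (N : ℝ → ℝ) (hN : IntervalIntegrable N volume 0 (π / 2))
    (h : ∀ j : ℕ, ∫ φ in (0:ℝ)..(π / 2), N φ * Real.sin φ ^ (2 * j) = 0)
    (p : Polynomial ℝ) :
    ∫ φ in (0:ℝ)..(π / 2), N φ * p.eval (Real.sin φ ^ 2) = 0 := by
  induction p using Polynomial.induction_on' with
  | add p q hp hq =>
    simp only [Polynomial.eval_add, mul_add]
    rw [intervalIntegral.integral_add, hp, hq, add_zero]
    · exact hN.mul_continuousOn (by fun_prop)
    · exact hN.mul_continuousOn (by fun_prop)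
  | monomial n a =>
    have : ∀ φ : ℝ, N φ * (Polynomial.monomial n a).eval (Real.sin φ ^ 2)
        = a * (N φ * Real.sin φ ^ (2 * n)) := by
      intro φ
      rw [Polynomial.eval_monomial, ← pow_mul]
      ring
    simp only [this]
    rw [intervalIntegral.integral_const_mul, h, mul_zero]

lemma cont_aux (N : ℝ → ℝ) (hN : IntervalIntegrable N volume 0 (π / 2))
    (h : ∀ j : ℕ, ∫ φ in (0:ℝ)..(π / 2), N φ * Real.sin φ ^ (2 * j) = 0)
    (g : ℝ → ℝ) (hg : Continuous g) :
    ∫ φ in (0:ℝ)..(π / 2), N φ * g φ = 0 := by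
  have hp := Real.pi_pos
  set C := ∫ φ in (0:ℝ)..(π / 2), |N φ| with hC
  have hC0 : 0 ≤ C := intervalIntegral.integral_nonneg (by linarith) (fun _ _ => abs_nonneg _)
  have key : ∀ ε : ℝ, 0 < ε → |∫ φ in (0:ℝ)..(π / 2), N φ * g φ| ≤ ε * C := by
    intro ε hε
    obtain ⟨p, hpp⟩ := exists_polynomial_near_of_continuousOn 0 1
      (fun t => g (Real.arcsin (Real.sqrt t)))
      (by fun_prop) ε hε
    have e : ∫ φ in (0:ℝ)..(π / 2), N φ * g φ
        = ∫ φ in (0:ℝ)..(π / 2), N φ * (g φ - p.eval (Real.sin φ ^ 2)) := by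
      simp only [mul_sub]
      rw [intervalIntegral.integral_sub, poly_aux N hN h p, sub_zero]
      · exact hN.mul_continuousOn (by fun_prop)
      · exact hN.mul_continuousOn (by fun_prop)
    rw [e, hC, ← intervalIntegral.integral_const_mul, ← Real.norm_eq_abs]
    apply intervalIntegral.norm_integral_le_of_norm_le (by linarith)
    · refine Filter.Eventually.of_forall fun x hx => ?_
      have hs : 0 ≤ Real.sin x := Real.sin_nonneg_of_nonneg_of_le_pi hx.1.le (by linarith [hx.2])
      have := hpp (Real.sin x ^ 2) ⟨by positivity, Real.sin_sq_le_one x⟩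
      rw [Real.sqrt_sq hs, Real.arcsin_sin (by linarith [hx.1]) hx.2, abs_sub_comm] at this
      rw [norm_mul, Real.norm_eq_abs, Real.norm_eq_abs, mul_comm]
      gcongr
    · exact hN.abs.const_mul ε
  have : |∫ φ in (0:ℝ)..(π / 2), N φ * g φ| ≤ 0 := by
    apply le_of_forall_pos_le_add
    intro δ hδ
    refine (key (δ / (C + 1)) (by positivity)).trans ?_
    rw [zero_add, div_mul_eq_mul_div, div_le_iff₀ (by positivity)]
    nlinarith
  exact abs_eq_zero.mp (le_antisymm this (abs_nonneg _))

/-- Proposition 33: if an even, π-periodic, square-integrable (on a period)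
function `N` is orthogonal to `sin ^ (2 j)` for every `j ≥ 0`, then `N = 0`
almost everywhere. -/
theorem eq_zero_of_forall_integral_sin_pow_eq_zero
    (N : ℝ → ℝ)
    (hmeas : Measurable N)
    (hper : Function.Periodic N (2 * π))
    (hL2 : MeasureTheory.IntegrableOn (fun φ => (N φ) ^ 2) (Set.Icc 0 (2 * π)))
    (heven : ∀ᵐ φ : ℝ, N (-φ) = N φ)
    (hpi : ∀ᵐ φ : ℝ, N (φ + π) = N φ)
    (h : ∀ j : ℕ, ∫ φ in (0:ℝ)..(2 * π), N φ * Real.sin φ ^ (2 * j) = 0) :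
    N =ᵐ[MeasureTheory.volume] 0 := by
  have hp := Real.pi_pos
  have hN : IntegrableOn N (Set.Icc 0 (2 * π)) := by
    have : MemLp N 2 (volume.restrict (Set.Icc 0 (2 * π))) :=
      (memLp_two_iff_integrable_sq hmeas.aestronglyMeasurable).2 hL2
    exact this.integrable (by norm_num)
  have hNi : IntervalIntegrable N volume 0 (2 * π) := by
    rw [intervalIntegrable_iff_integrableOn_Icc_of_le (by linarith)]
    exact hN
  have hNi2 : IntervalIntegrable N volume 0 (π / 2) := by
    apply hNi.mono_set
    rw [Set.uIcc_of_le (by linarith), Set.uIcc_of_le (by linarith)]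
    exact Set.Icc_subset_Icc le_rfl (by linarith)
  have h' : ∀ j : ℕ, ∫ φ in (0:ℝ)..(π / 2), N φ * Real.sin φ ^ (2 * j) = 0 := by
    intro j
    have := fold_aux (fun φ => N φ * Real.sin φ ^ (2 * j))
      (hNi.mul_continuousOn (by fun_prop))
      (by filter_upwards [heven] with x hx
          rw [hx, Real.sin_neg, pow_mul, pow_mul, neg_sq])
      (by filter_upwards [hpi] with x hx
          rw [hx, Real.sin_add_pi, pow_mul, pow_mul, neg_sq])
    rw [h j] at this
    linarith
  have hU : ∀ᵐ x : ℝ, x ∈ Set.Ioo 0 (π / 2) → N x = 0 := by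
    apply isOpen_Ioo.ae_eq_zero_of_integral_contDiff_smul_eq_zero
    · exact (hN.mono_set (fun x hx => ⟨hx.1.le, by linarith [hx.2]⟩)).locallyIntegrableOn
    · intro g hg _ hs
      have := cont_aux N hNi2 h' g hg.continuous
      rw [intervalIntegral.integral_of_le (by linarith)] at this
      rw [← this, ← setIntegral_eq_integral_of_forall_compl_eq_zero (s := Set.Ioc 0 (π / 2))]
      · simp [mul_comm]
      · intro x hx
        rw [image_eq_zero_of_notMem_tsupport (fun hx' => hx (Set.Ioo_subset_Ioc_self (hs hx'))),
          zero_smul]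
  -- extend to the symmetric interval
  have hneg : ∀ᵐ x : ℝ, -x ∈ Set.Ioo 0 (π / 2) → N (-x) = 0 :=
    (Measure.measurePreserving_neg (volume : Measure ℝ)).quasiMeasurePreserving.ae hU
  have h0 : ∀ᵐ x : ℝ, x ≠ 0 := Measure.ae_ne volume 0
  have h1 : ∀ᵐ x : ℝ, x ≠ π / 2 := Measure.ae_ne volume _
  have hS : ∀ᵐ x : ℝ, x ∈ Set.Ioc (-(π / 2)) (π / 2) → N x = 0 := by
    filter_upwards [hU, hneg, heven, h0, h1] with x a b c d e hx
    rcases lt_or_gt_of_ne d with d | d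
    · rw [← c]
      exact b ⟨by linarith, by linarith [hx.1]⟩
    · exact a ⟨d, lt_of_le_of_ne hx.2 e⟩
  have hS' : ∀ᵐ x : ℝ, ∀ k : ℤ, x + k * π ∈ Set.Ioc (-(π / 2)) (π / 2) → N (x + k * π) = 0 := by
    rw [ae_all_iff]
    intro k
    exact (measurePreserving_add_right (volume : Measure ℝ) (k * π)).quasiMeasurePreserving.ae hS
  have hP : ∀ᵐ x : ℝ, ∀ k : ℤ, N (x + k * π + π) = N (x + k * π) := by
    rw [ae_all_iff]
    intro k
    exact (measurePreserving_add_right (volume : Measure ℝ) (k * π)).quasiMeasurePreserving.ae hpi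
  filter_upwards [hS', hP] with x hx hk
  have hall : ∀ k : ℤ, N (x + k * π) = N x := by
    intro k
    induction k using Int.induction_on with
    | zero => simp
    | succ i ih =>
      rw [← ih, ← hk i]
      congr 1
      push_cast
      ring
    | pred i ih =>
      rw [← ih, ← hk (-(i:ℤ) - 1)]
      congr 1
      push_cast
      ring
  obtain ⟨k, hk', -⟩ := existsUnique_add_zsmul_mem_Ioc hp x (-(π / 2))
  rw [zsmul_eq_mul] at hk'
  rw [← hall k]
  exact hx k ⟨hk'.1, by linarith [hk'.2]⟩
end

section
/- Let N : ℝ → ℝ be 2π-periodic, square-integrable on [0, 2π], even (N(-φ) = N(φ) for almost every φ) and π-periodic (N(φ + π) = N(φ) for almost every φ). Let 0 ≤ e < 1. If ∫_0^{2π} N(φ) / √(1 - k² sin²φ) dφ = 0 for every k in the open interval (e, 1), then N = 0 almost everywhere. -/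
open Real MeasureTheory

lemma ek_coeff : ∃ c : ℕ → ℝ, (∀ n, c n ≠ 0) ∧
    (∀ x : ℝ, |x| < 1 → HasSum (fun n => c n * x ^ n) (1 / √(1 - x))) ∧
    (∀ x : ℝ, |x| < 1 → Summable (fun n => |c n| * |x| ^ n)) := by
  have H := Real.one_div_one_sub_rpow_hasFPowerSeriesOnBall_zero (1/2)
  have hb : ∀ x : ℝ, |x| < 1 → x ∈ Metric.eball (0:ℝ) 1 := by
    intro x hx
    rw [← ENNReal.ofReal_one, Metric.eball_ofReal]
    simpa using hx
  refine ⟨fun n => Ring.choose ((1/2:ℝ) + n - 1) n, ?_, ?_, ?_⟩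
  · intro n
    beta_reduce
    rw [Ring.choose_eq_smul, ← Polynomial.eval₂_smulOneHom_eq_smeval, Polynomial.eval₂_eq_eval_map,
      descPochhammer_map, descPochhammer_eval_eq_prod_range]
    refine smul_ne_zero (by positivity) (Finset.prod_ne_zero_iff.2 fun j hj => ?_)
    have : (j:ℝ) + 1 ≤ n := by exact_mod_cast Finset.mem_range.1 hj
    apply ne_of_gt
    linarith
  · intro x hx
    have := H.hasSum (hb x hx)
    simpa [FormalMultilinearSeries.ofScalars_apply_eq, Real.sqrt_eq_rpow, mul_comm] using this
  · intro x hx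
    have := FormalMultilinearSeries.summable_norm_apply _ (x := x)
      (Metric.eball_subset_eball H.r_le (hb x hx))
    simpa [FormalMultilinearSeries.ofScalars_apply_eq, abs_mul, mul_comm] using this

lemma ek_moments (N : ℝ → ℝ) (hN : IntervalIntegrable N volume 0 (2 * π))
    (e : ℝ) (he0 : 0 ≤ e) (he1 : e < 1)
    (h : ∀ k : ℝ, e < k → k < 1 →
      ∫ φ in (0:ℝ)..(2 * π), N φ / Real.sqrt (1 - k ^ 2 * Real.sin φ ^ 2) = 0) (n : ℕ) :
    ∫ φ in (0:ℝ)..(2 * π), N φ * (sin φ ^ 2) ^ n = 0 := by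
  obtain ⟨c, hc0, hc1, hc2⟩ := ek_coeff
  set m : ℕ → ℝ := fun n => ∫ φ in (0:ℝ)..(2 * π), N φ * (sin φ ^ 2) ^ n with hm
  set G : ℝ → ℝ := fun t => ∫ φ in (0:ℝ)..(2 * π), N φ / √(1 - t * sin φ ^ 2) with hG
  have hsum : ∀ t : ℝ, |t| < 1 → HasSum (fun n => c n * m n * t ^ n) (G t) := by
    intro t ht
    have key : HasSum (fun n => ∫ φ in (0:ℝ)..(2 * π), c n * t ^ n * (N φ * (sin φ ^ 2) ^ n))
        (G t) := by
      refine intervalIntegral.hasSum_integral_of_dominated_convergence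
        (fun n φ => |c n| * |t| ^ n * |N φ|) ?_ ?_ ?_ ?_ ?_
      · intro n
        refine AEStronglyMeasurable.const_mul ?_ _
        refine AEStronglyMeasurable.mul hN.def'.aestronglyMeasurable ?_
        exact (by fun_prop : Continuous fun φ : ℝ => (sin φ ^ 2) ^ n).aestronglyMeasurable
      · intro n
        refine ae_of_all _ fun φ _ => ?_
        have h1 : |(sin φ ^ 2) ^ n| ≤ 1 := by
          rw [abs_of_nonneg (by positivity)]
          exact pow_le_one₀ (by positivity) (sin_sq_le_one φ)
        rw [Real.norm_eq_abs, abs_mul, abs_mul, abs_mul, abs_pow]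
        gcongr
        exact mul_le_of_le_one_right (abs_nonneg _) h1
      · exact ae_of_all _ fun φ _ => (hc2 t ht).mul_right _
      · simp_rw [tsum_mul_right]
        exact hN.abs.const_mul _
      · refine ae_of_all _ fun φ _ => ?_
        have hx : |t * sin φ ^ 2| < 1 := by
          rw [abs_mul, abs_of_nonneg (sq_nonneg (sin φ))]
          exact lt_of_le_of_lt (mul_le_of_le_one_right (abs_nonneg _) (sin_sq_le_one φ)) ht
        have := (hc1 _ hx).mul_left (N φ)
        rw [mul_one_div] at this
        refine this.congr_fun ?_
        intro n
        rw [mul_pow]; ring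
    refine key.congr_fun ?_
    intro n
    rw [intervalIntegral.integral_const_mul]
    simp only [hm]; ring
  have hb : ∀ x : ℝ, x ∈ Metric.eball (0:ℝ) 1 ↔ |x| < 1 := by
    intro x
    rw [← ENNReal.ofReal_one, Metric.eball_ofReal]
    simp
  have HF : HasFPowerSeriesOnBall G
      (FormalMultilinearSeries.ofScalars ℝ fun n => c n * m n) 0 1 := by
    refine ⟨?_, one_pos, ?_⟩
    · refine ENNReal.le_of_forall_nnreal_lt fun r hr => ?_
      apply FormalMultilinearSeries.le_radius_of_summable
      have hr' : |(r:ℝ)| < 1 := by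
        rw [abs_of_nonneg r.coe_nonneg]; exact_mod_cast hr
      have := (hsum r hr').summable.abs
      simpa [FormalMultilinearSeries.ofScalars_norm, abs_mul] using this
    · intro y hy
      have := hsum y ((hb y).1 hy)
      simpa [FormalMultilinearSeries.ofScalars_apply_eq, mul_comm, mul_assoc, mul_left_comm]
        using this
  have hz : ∀ t, e ^ 2 < t → t < 1 → G t = 0 := by
    intro t h1 h2
    have ht : 0 ≤ t := (sq_nonneg e).trans h1.le
    have := h (√t) (by rwa [Real.lt_sqrt he0]) (by rw [Real.sqrt_lt' one_pos]; simpa using h2)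
    rwa [Real.sq_sqrt ht] at this
  have he2 : e ^ 2 < 1 := by nlinarith
  have hE : Set.EqOn G 0 (Metric.eball 0 1) := by
    refine HF.analyticOnNhd.eqOn_zero_of_preconnected_of_eventuallyEq_zero ?_
      (z₀ := (e ^ 2 + 1) / 2) ?_ ?_
    · rw [← ENNReal.ofReal_one, Metric.eball_ofReal]
      exact (convex_ball _ _).isPreconnected
    · rw [hb, abs_of_nonneg (by positivity)]; linarith
    · filter_upwards [Ioo_mem_nhds (a := e ^ 2) (b := 1) (by linarith) (by linarith)] with t ht
      exact hz t ht.1 ht.2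
  have HF0 : HasFPowerSeriesOnBall (0 : ℝ → ℝ)
      (FormalMultilinearSeries.ofScalars ℝ fun n => c n * m n) 0 1 := HF.congr hE
  have hp := HF0.hasFPowerSeriesAt.eq_zero
  have := congrArg (fun p => FormalMultilinearSeries.coeff p n) hp
  simp only [FormalMultilinearSeries.coeff_ofScalars] at this
  have h0 : c n * m n = 0 := by rw [this]; rfl
  exact (mul_eq_zero.1 h0).resolve_left (hc0 n)

lemma ek_poly (N : ℝ → ℝ) (hN : IntervalIntegrable N volume 0 (2 * π))
    (h : ∀ n : ℕ, ∫ φ in (0:ℝ)..(2 * π), N φ * (sin φ ^ 2) ^ n = 0) (P : Polynomial ℝ) :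
    ∫ φ in (0:ℝ)..(2 * π), N φ * P.eval (sin φ ^ 2) = 0 := by
  induction P using Polynomial.induction_on' with
  | add p q hp hq =>
    simp only [Polynomial.eval_add, mul_add]
    rw [intervalIntegral.integral_add, hp, hq, add_zero]
    · exact hN.mul_continuousOn (by fun_prop)
    · exact hN.mul_continuousOn (by fun_prop)
  | monomial n a =>
    simp only [Polynomial.eval_monomial]
    simp_rw [mul_left_comm _ a]
    rw [intervalIntegral.integral_const_mul, h, mul_zero]

lemma ek_sin (N : ℝ → ℝ) (hper : Function.Periodic N (2 * π))
    (heven : ∀ᵐ φ : ℝ, N (-φ) = N φ) (n : ℤ) :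
    ∫ φ in (0:ℝ)..(2 * π), N φ * sin (n * φ) = 0 := by
  have hp : Function.Periodic (fun φ => N φ * sin (n * φ)) (2 * π) := by
    intro x
    have : (n:ℝ) * (x + 2 * π) = n * x + n * (2 * π) := by ring
    simp only [hper x, this, Real.sin_add_int_mul_two_pi]
  have h1 := hp.intervalIntegral_add_eq 0 (-π)
  rw [zero_add, show -π + 2 * π = π by ring] at h1
  have h2 : ∫ φ in (-π)..π, N φ * sin (n * φ) = - ∫ φ in (-π)..π, N φ * sin (n * φ) := by
    have := intervalIntegral.integral_comp_neg (a := -π) (b := π) (fun φ => N φ * sin (n * φ))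
    rw [neg_neg] at this
    rw [← intervalIntegral.integral_neg]
    rw [← this]
    apply intervalIntegral.integral_congr_ae
    filter_upwards [heven] with x hx _
    rw [hx, mul_neg, sin_neg, mul_neg]
  linarith

lemma ek_cos_odd (N : ℝ → ℝ) (hper : Function.Periodic N (2 * π))
    (hpi : ∀ᵐ φ : ℝ, N (φ + π) = N φ) (j : ℤ) :
    ∫ φ in (0:ℝ)..(2 * π), N φ * cos ((2 * j + 1 : ℤ) * φ) = 0 := by
  have hp : Function.Periodic (fun φ => N φ * cos ((2 * j + 1 : ℤ) * φ)) (2 * π) := by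
    intro x
    have : ((2 * j + 1 : ℤ):ℝ) * (x + 2 * π)
      = (2 * j + 1 : ℤ) * x + (2 * j + 1 : ℤ) * (2 * π) := by ring
    simp only [hper x, this, Real.cos_add_int_mul_two_pi]
  have h1 := hp.intervalIntegral_add_eq 0 π
  rw [zero_add] at h1
  have h2 : ∫ φ in π..(π + 2 * π), N φ * cos ((2 * j + 1 : ℤ) * φ)
      = - ∫ φ in (0:ℝ)..(2 * π), N φ * cos ((2 * j + 1 : ℤ) * φ) := by
    have := intervalIntegral.integral_comp_add_right (a := 0) (b := 2 * π)
      (fun φ => N φ * cos ((2 * j + 1 : ℤ) * φ)) π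
    rw [zero_add, add_comm (2 * π)] at this
    rw [← this, ← intervalIntegral.integral_neg]
    apply intervalIntegral.integral_congr_ae
    filter_upwards [hpi] with x hx _
    have h3 : ((2 * j + 1 : ℤ):ℝ) * (x + π) = ((2 * j + 1 : ℤ) * x + π) + j * (2 * π) := by
      push_cast; ring
    rw [hx, h3, Real.cos_add_int_mul_two_pi, cos_add_pi, mul_neg]
  linarith

lemma ek_cos (N : ℝ → ℝ) (hN : IntervalIntegrable N volume 0 (2 * π))
    (hper : Function.Periodic N (2 * π))
    (hpi : ∀ᵐ φ : ℝ, N (φ + π) = N φ)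
    (h : ∀ n : ℕ, ∫ φ in (0:ℝ)..(2 * π), N φ * (sin φ ^ 2) ^ n = 0) (n : ℤ) :
    ∫ φ in (0:ℝ)..(2 * π), N φ * cos (n * φ) = 0 := by
  obtain ⟨j, hj | hj⟩ := Int.even_or_odd' n
  · have := ek_poly N hN h ((Polynomial.Chebyshev.T ℝ j).comp
      (1 - Polynomial.C 2 * Polynomial.X))
    rw [← this]
    congr 1
    ext φ
    have h2 : 1 - 2 * sin φ ^ 2 = cos (2 * φ) := by
      rw [cos_two_mul, cos_sq']; ring
    simp only [Polynomial.eval_comp, Polynomial.eval_sub, Polynomial.eval_one,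
      Polynomial.eval_mul, Polynomial.eval_C, Polynomial.eval_X, h2,
      Polynomial.Chebyshev.T_real_cos]
    rw [hj]
    congr 2
    push_cast; ring
  · rw [hj]
    exact ek_cos_odd N hper hpi j

/-- Analytic core of Proposition 36 ("ellipses are total"): an even,
π-periodic, square-integrable function `N` whose integrals against the
elliptic kernels `(1 - k² sin²φ)^{-1/2}` vanish for all moduli `k ∈ (e, 1)`
must vanish almost everywhere. -/
theorem eq_zero_of_forall_integral_elliptic_kernel_eq_zero
    (N : ℝ → ℝ)
    (hmeas : Measurable N)
    (hper : Function.Periodic N (2 * π))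
    (hL2 : MeasureTheory.IntegrableOn (fun φ => (N φ) ^ 2) (Set.Icc 0 (2 * π)))
    (heven : ∀ᵐ φ : ℝ, N (-φ) = N φ)
    (hpi : ∀ᵐ φ : ℝ, N (φ + π) = N φ)
    (e : ℝ) (he0 : 0 ≤ e) (he1 : e < 1)
    (h : ∀ k : ℝ, e < k → k < 1 →
      ∫ φ in (0:ℝ)..(2 * π), N φ / Real.sqrt (1 - k ^ 2 * Real.sin φ ^ 2) = 0) :
    N =ᵐ[MeasureTheory.volume] 0 := by
  have h2pi : (0:ℝ) < 2 * π := by positivity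
  have hL2' : IntegrableOn (fun φ => (N φ) ^ 2) (Set.Ioc 0 (2 * π)) :=
    hL2.mono_set Set.Ioc_subset_Icc_self
  have hMem : MemLp N 2 (volume.restrict (Set.Ioc 0 (2 * π))) :=
    (memLp_two_iff_integrable_sq hmeas.aestronglyMeasurable).2 hL2'
  have hN : IntervalIntegrable N volume 0 (2 * π) := by
    rw [intervalIntegrable_iff_integrableOn_Ioc_of_le h2pi.le]
    exact hMem.integrable one_le_two
  have hR : ∀ f : ℝ → ℝ, IntervalIntegrable f volume 0 (2 * π) →
      IntervalIntegrable (fun x => (f x : ℂ)) volume 0 (2 * π) :=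
    fun f hf => ⟨Integrable.ofReal hf.1, Integrable.ofReal hf.2⟩
  have hmom := ek_moments N hN e he0 he1 h
  have hcoef : ∀ n : ℤ, fourierCoeffOn h2pi (fun x => (N x : ℂ)) n = 0 := by
    intro n
    rw [fourierCoeffOn_eq_integral]
    have hi : ∫ x in (0:ℝ)..(2 * π),
        (fourier (-n) : AddCircle (2 * π - 0) → ℂ) (x : AddCircle (2 * π - 0)) • (N x : ℂ) = 0 := by
      have hpt : ∀ x : ℝ,
          (fourier (-n) : AddCircle (2 * π - 0) → ℂ) (x : AddCircle (2 * π - 0)) • (N x : ℂ)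
          = ((N x * cos (n * x) : ℝ) : ℂ) - Complex.I * ((N x * sin (n * x) : ℝ) : ℂ) := by
        intro x
        have hpc : (π : ℂ) ≠ 0 := by exact_mod_cast Real.pi_ne_zero
        rw [fourier_coe_apply]
        have : 2 * (π:ℂ) * Complex.I * ((-n : ℤ) : ℂ) * x / ((2 * π - 0 : ℝ) : ℂ)
            = (-(n * x) : ℂ) * Complex.I := by
          push_cast
          field_simp
          ring
        rw [this, Complex.exp_mul_I, Complex.cos_neg, Complex.sin_neg, smul_eq_mul]
        push_cast
        ring
      simp_rw [hpt]
      rw [intervalIntegral.integral_sub, intervalIntegral.integral_const_mul,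
        intervalIntegral.integral_ofReal, intervalIntegral.integral_ofReal,
        ek_cos N hN hper hpi hmom, ek_sin N hper heven]
      · simp
      · exact hR _ (hN.mul_continuousOn (g := fun x => cos (n * x)) (by fun_prop))
      · exact (hR _ (hN.mul_continuousOn (g := fun x => sin (n * x)) (by fun_prop))).const_mul _
    rw [hi, smul_zero]
  have hpars := tsum_sq_fourierCoeffOn (f := fun x => (N x : ℂ)) h2pi hMem.ofReal
  simp only [hcoef, norm_zero, ne_eq, OfNat.ofNat_ne_zero, not_false_eq_true, zero_pow, tsum_zero,
    Complex.norm_real, Real.norm_eq_abs, sq_abs, sub_zero, smul_eq_mul] at hpars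
  have hint : ∫ x in Set.Ioc 0 (2 * π), N x ^ 2 = 0 := by
    rw [intervalIntegral.integral_of_le h2pi.le] at hpars
    exact (mul_eq_zero.1 hpars.symm).resolve_left (by positivity)
  rw [setIntegral_eq_zero_iff_of_nonneg_ae (ae_of_all _ fun x => sq_nonneg (N x)) hL2'] at hint
  have hae : ∀ᵐ x : ℝ, x ∈ Set.Ioc 0 (2 * π) → N x = 0 := by
    rw [← ae_restrict_iff' measurableSet_Ioc]
    filter_upwards [hint] with x hx
    simpa using hx
  have hall : ∀ᵐ x : ℝ, ∀ n : ℤ, x - n • (2 * π) ∈ Set.Ioc 0 (2 * π) →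
      N (x - n • (2 * π)) = 0 := by
    rw [ae_all_iff]
    intro n
    exact (measurePreserving_sub_right volume (n • (2 * π))).quasiMeasurePreserving.ae hae
  filter_upwards [hall] with x hx
  obtain ⟨n, hn, -⟩ := existsUnique_sub_zsmul_mem_Ioc h2pi x 0
  have := hx n (by simpa using hn)
  rwa [hper.sub_zsmul_eq] at this
end
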